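/- arXiv:1304.6510 — 3 statements merged into one kernel-verified Lean document; each statement's English description precedes it below -/
import Mathlib

section
/- Fix an integer t ≥ 2. Assume that every K_{t+1}-minor-free graph has minimum degree at most δ, and that every K_t-minor-free graph with exactly δ vertices has an independent set of size α. Then every K_{t+1}-minor-free graph has chromatic number at most δ − α + 2. -/
/-- `H` is a minor of `G`: there is a family of nonempty, pairwise disjoint,
connected branch sets in `G`, one for each vertex of `H`, such that adjacent
vertices of `H` have adjacent branch sets. -/
def SimpleGraph.IsMinorOf {W V : Type*} (H : SimpleGraph W) (G : SimpleGraph V) : Prop :=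
  ∃ B : W → Set V,
    (∀ w, (B w).Nonempty) ∧
    (∀ w, (G.induce (B w)).Connected) ∧
    (Pairwise fun w₁ w₂ => Disjoint (B w₁) (B w₂)) ∧
    ∀ ⦃w₁ w₂⦄, H.Adj w₁ w₂ → ∃ v₁ ∈ B w₁, ∃ v₂ ∈ B w₂, G.Adj v₁ v₂

/-- `G` has no `K_t`-minor. -/
def SimpleGraph.KMinorFree {V : Type*} (G : SimpleGraph V) (t : ℕ) : Prop :=
  ¬ (completeGraph (Fin t)).IsMinorOf G

namespace SimpleGraph

theorem IsMinorOf.trans {U W V : Type*} {K : SimpleGraph U} {H : SimpleGraph W}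
    {G : SimpleGraph V} (hKH : K.IsMinorOf H) (hHG : H.IsMinorOf G) : K.IsMinorOf G := by
  obtain ⟨B, hBne, hBc, hBd, hBa⟩ := hKH
  obtain ⟨C, hCne, hCc, hCd, hCa⟩ := hHG
  have hmem {u : U} {w : W} (hw : w ∈ B u) {x : V} (hx : x ∈ C w) : x ∈ ⋃ w ∈ B u, C w :=
    Set.mem_biUnion hw hx
  have hbranch (u : U) (w : W) (hw : w ∈ B u) (x y : V) (hx : x ∈ C w) (hy : y ∈ C w) :
      (G.induce (⋃ w ∈ B u, C w)).Reachable ⟨x, hmem hw hx⟩ ⟨y, hmem hw hy⟩ :=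
    ((hCc w).preconnected ⟨x, hx⟩ ⟨y, hy⟩).map
      (G.induceHomOfLE (Set.subset_biUnion_of_mem hw)).toHom
  have hwalk (u : U) (a b : B u) (p : ((H.induce (B u)).Walk a b)) :
      ∀ (x y : V) (hx : x ∈ C a) (hy : y ∈ C b),
        (G.induce (⋃ w ∈ B u, C w)).Reachable ⟨x, hmem a.2 hx⟩ ⟨y, hmem b.2 hy⟩ := by
    induction p with
    | nil => exact fun x y hx hy => hbranch u _ (Subtype.prop _) x y hx hy
    | cons hadj p ih =>
      intro x y hx hy
      obtain ⟨x', hx', y', hy', hxy⟩ := hCa hadj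
      refine (hbranch u _ (Subtype.prop _) x x' hx hx').trans ?_
      refine Reachable.trans (Adj.reachable ?_) (ih y' y hy' hy)
      exact hxy
  refine ⟨fun u => ⋃ w ∈ B u, C w, fun u => ?_, fun u => ?_, fun u u' hu => ?_, fun u u' hu => ?_⟩
  · obtain ⟨w, hw⟩ := hBne u
    obtain ⟨x, hx⟩ := hCne w
    exact ⟨x, hmem hw hx⟩
  · obtain ⟨w, hw⟩ := hBne u
    obtain ⟨x, hx⟩ := hCne w
    have : Nonempty ↥(⋃ w ∈ B u, C w) := ⟨⟨x, hmem hw hx⟩⟩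
    refine ⟨?_⟩
    rintro ⟨x, hx⟩ ⟨y, hy⟩
    obtain ⟨a, ha, hxa⟩ := Set.mem_iUnion₂.1 hx
    obtain ⟨b, hb, hyb⟩ := Set.mem_iUnion₂.1 hy
    obtain ⟨p⟩ := (hBc u).preconnected ⟨a, ha⟩ ⟨b, hb⟩
    exact hwalk u _ _ p x y hxa hyb
  · refine Set.disjoint_left.2 fun x hx hx' => ?_
    obtain ⟨a, ha, hxa⟩ := Set.mem_iUnion₂.1 hx
    obtain ⟨b, hb, hxb⟩ := Set.mem_iUnion₂.1 hx'
    by_cases hab : a = b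
    · subst hab
      exact Set.disjoint_left.1 (hBd hu) ha hb
    · exact Set.disjoint_left.1 (hCd hab) hxa hxb
  · obtain ⟨a, ha, b, hb, hab⟩ := hBa hu
    obtain ⟨x, hx, y, hy, hxy⟩ := hCa hab
    exact ⟨x, hmem ha hx, y, hmem hb hy, hxy⟩

theorem KMinorFree.of_isMinorOf {W V : Type*} {H : SimpleGraph W} {G : SimpleGraph V} {t : ℕ}
    (hG : G.KMinorFree t) (hHG : H.IsMinorOf G) : H.KMinorFree t :=
  fun hK => hG (hK.trans hHG)

/-- The image of `G` under a retraction `f` onto a set of representatives is a minor of `G` as soon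
as every vertex is equal or adjacent to its representative. -/
theorem isMinorOf_of_retraction {V : Type*} {G : SimpleGraph V} {s : Set V} {H : SimpleGraph s}
    (f : V → s) (hf : ∀ a : s, f a = a) (hstar : ∀ x, x = f x ∨ G.Adj x (f x))
    (hH : ∀ ⦃a b⦄, H.Adj a b → ∃ x y, f x = a ∧ f y = b ∧ G.Adj x y) : H.IsMinorOf G := by
  refine ⟨fun a => {x | f x = a}, fun a => ⟨a, hf a⟩, fun a => ?_, fun a b hab => ?_,
    fun a b hab => ?_⟩
  · rw [connected_iff_exists_forall_reachable]
    refine ⟨⟨a, hf a⟩, ?_⟩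
    rintro ⟨x, rfl⟩
    rcases hstar x with hx | hx
    · have : (⟨f x, hf (f x)⟩ : {y | f y = f x}) = ⟨x, rfl⟩ := Subtype.ext hx.symm
      rw [this]
    · exact Adj.reachable (G := G.induce {y | f y = f x}) hx.symm
  · exact Set.disjoint_left.2 fun x hx hx' => hab (hx.symm.trans hx')
  · obtain ⟨x, y, hx, hy, hxy⟩ := hH hab
    exact ⟨x, hx, y, hy, hxy⟩

theorem connected_induce_singleton {V : Type*} (G : SimpleGraph V) (v : V) :
    (G.induce {v}).Connected :=
  ⟨.of_subsingleton⟩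

theorem induce_isMinorOf {V : Type*} (G : SimpleGraph V) (s : Set V) :
    (G.induce s).IsMinorOf G := by
  refine ⟨fun a => {(a : V)}, fun a => Set.singleton_nonempty _, fun a => G.connected_induce_singleton a,
    fun a b hab => ?_, fun a b hab => ⟨a, rfl, b, rfl, hab⟩⟩
  simpa [Subtype.ext_iff] using hab

/-- In a `K_{t+1}`-minor-free graph, neighbourhoods are `K_t`-minor-free, even after adding isolated
vertices. -/
theorem KMinorFree.induce_neighborSet_sum_bot {V I : Type*} {G : SimpleGraph V} {t : ℕ}
    (ht : 2 ≤ t) (hG : G.KMinorFree (t + 1)) (v : V) :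
    (G.induce (G.neighborSet v) ⊕g (⊥ : SimpleGraph I)).KMinorFree t := by
  rintro ⟨B, hne, hc, hd, ha⟩
  have : Nontrivial (Fin t) := Fin.nontrivial_iff_two_le.2 ht
  have hinl (w : Fin t) (z) (hz : z ∈ B w) : ∃ x, z = Sum.inl x := by
    rcases z with x | i
    · exact ⟨x, rfl⟩
    exfalso
    obtain ⟨w', hw'⟩ := exists_ne w
    obtain ⟨a, haw, b, -, hab⟩ := ha (w₁ := w) (w₂ := w') hw'.symm
    obtain ⟨p⟩ := (hc w).preconnected ⟨Sum.inr i, hz⟩ ⟨a, haw⟩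
    cases p with
    | nil => cases b <;> simp at hab
    | cons h p =>
      rename_i y
      obtain ⟨y | y, hy⟩ := y <;> simp at h
  let g : (G.induce (G.neighborSet v) ⊕g (⊥ : SimpleGraph I)) →g G :=
    ⟨Sum.elim (fun x => (x : V)) (fun _ => v), by rintro (x | x) (y | y) h <;> simp_all⟩
  have hvnot (w : Fin t) : v ∉ g '' B w := by
    rintro ⟨z, hz, hzv⟩
    obtain ⟨x, rfl⟩ := hinl w z hz
    have hx : (x : V) = v := hzv
    exact G.loopless.irrefl v (by simpa [hx] using x.2)
  refine hG ⟨Fin.cons {v} fun w => g '' B w, ?_, ?_, ?_, ?_⟩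
  · refine Fin.cases (Set.singleton_nonempty _) fun w => (hne w).image g
  · refine Fin.cases ?_ fun w => ?_
    · exact G.connected_induce_singleton v
    · refine (hc w).map (induceHom g (Set.mapsTo_image g (B w))) ?_
      rintro ⟨_, z, hz, rfl⟩
      exact ⟨⟨z, hz⟩, rfl⟩
  · intro w w' hww'
    induction w using Fin.cases with
    | zero =>
      induction w' using Fin.cases with
      | zero => exact absurd rfl hww'
      | succ w' => exact Set.disjoint_singleton_left.2 (hvnot w')
    | succ w =>
      induction w' using Fin.cases with
      | zero => exact Set.disjoint_singleton_right.2 (hvnot w)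
      | succ w' =>
        refine Set.disjoint_left.2 ?_
        rintro _ ⟨z, hz, rfl⟩ ⟨z', hz', hzz'⟩
        obtain ⟨x, rfl⟩ := hinl w z hz
        obtain ⟨x', rfl⟩ := hinl w' z' hz'
        obtain rfl : x' = x := Subtype.ext hzz'
        exact Set.disjoint_left.1 (hd fun h => hww' (congrArg Fin.succ h)) hz hz'
  · have hstar (w : Fin t) : ∃ x ∈ g '' B w, G.Adj v x := by
      obtain ⟨z, hz⟩ := hne w
      obtain ⟨x, rfl⟩ := hinl w z hz
      exact ⟨x, ⟨_, hz, rfl⟩, x.2⟩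
    intro w w' hww'
    induction w using Fin.cases with
    | zero =>
      induction w' using Fin.cases with
      | zero => exact absurd rfl hww'.ne
      | succ w' =>
        obtain ⟨x, hx, hvx⟩ := hstar w'
        exact ⟨v, rfl, x, hx, hvx⟩
    | succ w =>
      induction w' using Fin.cases with
      | zero =>
        obtain ⟨x, hx, hvx⟩ := hstar w
        exact ⟨x, hx, v, rfl, hvx.symm⟩
      | succ w' =>
        obtain ⟨a, ha, b, hb, hab⟩ := ha (w₁ := w) (w₂ := w') fun h => hww'.ne (congrArg Fin.succ h)
        exact ⟨g a, ⟨a, ha, rfl⟩, g b, ⟨b, hb, rfl⟩, g.map_adj hab⟩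

theorem KMinorFree.exists_indep_subset_neighborFinset {t δ α : ℕ} (ht : 2 ≤ t)
    (hα : ∀ (V : Type) [Fintype V] (G : SimpleGraph V),
      G.KMinorFree t → Fintype.card V = δ →
      ∃ S : Finset V, S.card = α ∧ ∀ v ∈ S, ∀ w ∈ S, v ≠ w → ¬ G.Adj v w)
    {V : Type} [Fintype V] {G : SimpleGraph V} [DecidableRel G.Adj] (hG : G.KMinorFree (t + 1))
    {v : V} (hv : G.degree v ≤ δ) :
    ∃ S ⊆ G.neighborFinset v, (∀ x ∈ S, ∀ y ∈ S, ¬ G.Adj x y) ∧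
      α ≤ δ ∧ α + G.degree v ≤ S.card + δ := by
  have hcard : Fintype.card (G.neighborSet v ⊕ Fin (δ - G.degree v)) = δ := by
    rw [Fintype.card_sum, G.card_neighborSet_eq_degree, Fintype.card_fin]
    omega
  obtain ⟨S, hS, hind⟩ := hα _ _ (hG.induce_neighborSet_sum_bot (I := Fin (δ - G.degree v)) ht v)
    hcard
  refine ⟨S.toLeft.map (Function.Embedding.subtype _), ?_, ?_, ?_, ?_⟩
  · intro x hx
    obtain ⟨y, -, rfl⟩ := Finset.mem_map.1 hx
    exact (G.mem_neighborFinset v _).2 y.2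
  · intro x hx y hy hxy
    obtain ⟨x, hx', rfl⟩ := Finset.mem_map.1 hx
    obtain ⟨y, hy', rfl⟩ := Finset.mem_map.1 hy
    refine hind _ (Finset.mem_toLeft.1 hx') _ (Finset.mem_toLeft.1 hy') ?_ (by simpa using hxy)
    rintro h
    exact hxy.ne (congrArg _ (Sum.inl_injective h))
  · exact (hS.symm.trans_le S.card_le_univ).trans hcard.le
  · have h := S.card_toLeft_add_card_toRight
    have h' := S.toRight.card_le_univ
    rw [Fintype.card_fin] at h'
    rw [Finset.card_map]
    omega

theorem colorable_of_coloring_off_vertex {V : Type*} [DecidableEq V] {G : SimpleGraph V} {k : ℕ}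
    (v : V) [Fintype (G.neighborSet v)] (c : V → Fin k)
    (hc : ∀ ⦃x y⦄, x ≠ v → y ≠ v → G.Adj x y → c x ≠ c y)
    (hv : ((G.neighborFinset v).image c).card < k) : G.Colorable k := by
  obtain ⟨i, hi⟩ : ∃ i, i ∉ (G.neighborFinset v).image c := by
    by_contra! h
    have := Finset.card_le_card (fun i _ => h i : Finset.univ ⊆ (G.neighborFinset v).image c)
    simp only [Finset.card_univ, Fintype.card_fin] at this
    omega
  have hi' (y : V) (hy : G.Adj v y) : i ≠ c y := fun h =>
    hi (h ▸ Finset.mem_image_of_mem c ((G.mem_neighborFinset v y).2 hy))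
  refine ⟨Coloring.mk (Function.update c v i) fun {x y} hxy => ?_⟩
  by_cases hx : x = v
  · subst hx
    simpa [Function.update_of_ne hxy.ne'] using hi' y hxy
  · by_cases hy : y = v
    · subst hy
      simpa [Function.update_of_ne hx] using (hi' x hxy.symm).symm
    · simpa [hx, hy] using hc hx hy hxy

/-- Colour `G` from colourings of smaller minors, by deleting `v` or by contracting an independent
set `S` of neighbours of `v` onto `v`. -/
theorem colorable_of_forall_smaller_minor {V : Type} [Fintype V] [DecidableEq V]
    {G : SimpleGraph V} [DecidableRel G.Adj] {k : ℕ}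
    (ih : ∀ (s : Set V) (H : SimpleGraph s), s ≠ Set.univ → H.IsMinorOf G → H.Colorable k)
    {v : V} {S : Finset V} (hS : S ⊆ G.neighborFinset v) (hind : ∀ x ∈ S, ∀ y ∈ S, ¬ G.Adj x y)
    (hk : G.degree v + 2 ≤ S.card + k) : G.Colorable k := by
  rcases S.eq_empty_or_nonempty with rfl | ⟨s, hs⟩
  · simp only [Finset.card_empty] at hk
    obtain ⟨C⟩ := ih {v}ᶜ (G.induce {v}ᶜ) (by simp) (G.induce_isMinorOf _)
    refine colorable_of_coloring_off_vertex v
      (fun x => if hx : x ≠ v then C ⟨x, hx⟩ else ⟨0, by omega⟩) (fun x y hx hy hxy => ?_) ?_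
    · simp only [dif_pos hx, dif_pos hy]
      exact C.valid hxy
    · refine Finset.card_image_le.trans_lt ?_
      rw [card_neighborFinset_eq_degree]
      omega
  · have hvS : v ∉ S := fun h => by simpa using hS h
    let f (x : V) : ((↑S : Set V)ᶜ : Set V) := if hx : x ∈ S then ⟨v, hvS⟩ else ⟨x, hx⟩
    have hfS {x : V} (hx : x ∈ S) : f x = ⟨v, hvS⟩ := dif_pos hx
    have hf {x : V} (hx : x ∉ S) : f x = ⟨x, hx⟩ := dif_neg hx
    let H : SimpleGraph ((↑S : Set V)ᶜ : Set V) :=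
      .fromRel fun a b => ∃ x y, f x = a ∧ f y = b ∧ G.Adj x y
    have hH : H.IsMinorOf G := by
      refine isMinorOf_of_retraction f (fun a => hf a.2) (fun x => ?_) fun a b hab => ?_
      · by_cases hx : x ∈ S
        · rw [hfS hx]
          exact .inr ((G.mem_neighborFinset v x).1 (hS hx)).symm
        · rw [hf hx]
          exact .inl rfl
      · rcases ((fromRel_adj _ a b).1 hab).2 with h | ⟨x, y, hx, hy, hxy⟩
        · exact h
        · exact ⟨y, x, hy, hx, hxy.symm⟩
    obtain ⟨C⟩ := ih _ H (fun h => (h ▸ Set.mem_univ s : s ∈ (↑S : Set V)ᶜ) hs) hH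
    refine colorable_of_coloring_off_vertex v (fun x => C (f x)) (fun x y hx hy hxy => ?_) ?_
    · refine C.valid ((fromRel_adj _ _ _).2 ⟨fun h => ?_, .inl ⟨x, y, rfl, rfl, hxy⟩⟩)
      by_cases hxS : x ∈ S <;> by_cases hyS : y ∈ S
      · exact hind x hxS y hyS hxy
      · rw [hfS hxS, hf hyS] at h
        exact hy (congrArg Subtype.val h).symm
      · rw [hf hxS, hfS hyS] at h
        exact hx (congrArg Subtype.val h)
      · rw [hf hxS, hf hyS] at h
        exact hxy.ne (congrArg Subtype.val h)
    · have hsub : (G.neighborFinset v).image (fun x => C (f x)) ⊆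
          insert (C ⟨v, hvS⟩) ((G.neighborFinset v \ S).image fun x => C (f x)) := by
        intro i hi
        obtain ⟨x, hx, rfl⟩ := Finset.mem_image.1 hi
        by_cases hxS : x ∈ S
        · simp [hfS hxS]
        · exact Finset.mem_insert_of_mem
            (Finset.mem_image_of_mem _ (Finset.mem_sdiff.2 ⟨hx, hxS⟩))
      have h₁ := Finset.card_le_card hsub
      have h₂ := Finset.card_insert_le (C ⟨v, hvS⟩)
        ((G.neighborFinset v \ S).image fun x => C (f x))
      have h₃ := Finset.card_image_le (s := G.neighborFinset v \ S) (f := fun x => C (f x))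
      have h₄ := Finset.card_sdiff_add_card_eq_card hS
      rw [card_neighborFinset_eq_degree] at h₄
      omega

end SimpleGraph

theorem hadwiger_note_main (t δ α : ℕ) (ht : 2 ≤ t)
    (hδ : ∀ (V : Type) [Fintype V] (G : SimpleGraph V) [DecidableRel G.Adj],
      G.KMinorFree (t + 1) → G.minDegree ≤ δ)
    (hα : ∀ (V : Type) [Fintype V] (G : SimpleGraph V),
      G.KMinorFree t → Fintype.card V = δ →
      ∃ S : Finset V, S.card = α ∧ ∀ v ∈ S, ∀ w ∈ S, v ≠ w → ¬ G.Adj v w)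
    (V : Type) [Fintype V] (G : SimpleGraph V) (hG : G.KMinorFree (t + 1)) :
    G.chromaticNumber ≤ (δ - α + 2 : ℕ) := by
  classical
  rw [SimpleGraph.chromaticNumber_le_iff_colorable]
  induction hn : Fintype.card V using Nat.strong_induction_on generalizing V with
  | _ n ih =>
    rcases isEmpty_or_nonempty V with hV | hV
    · exact SimpleGraph.Colorable.of_isEmpty _
    · obtain ⟨v, hv⟩ := G.exists_minimal_degree_vertex
      obtain ⟨S, hS, hind, hle, hcard⟩ :=
        hG.exists_indep_subset_neighborFinset ht hα (hv ▸ hδ V G hG)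
      refine SimpleGraph.colorable_of_forall_smaller_minor (fun s H hs hH => ?_) hS hind (by omega)
      refine ih _ ?_ s H (hG.of_isMinorOf hH) rfl
      obtain ⟨x, hx⟩ := (Set.ne_univ_iff_exists_notMem s).1 hs
      exact hn ▸ Fintype.card_subtype_lt hx
end

section
/- Let γ = (80 − √5392)/126. Fix an integer t ≥ 6. Assume that every K_{t+1}-minor-free graph has minimum degree at most δ. Then every K_{t+1}-minor-free graph G satisfies χ(G) ≤ δ·(1 − 1/((2 − γ)·(t − 1))) + 2. -/
namespace SimpleGraph

/-- A minor of a subgraph is a minor. -/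
theorem IsMinorOf.of_injective_hom {U V W : Type*} {H : SimpleGraph U} {G : SimpleGraph V}
    {G' : SimpleGraph W} (f : G' →g G) (hf : Function.Injective f) (h : H.IsMinorOf G') :
    H.IsMinorOf G := by
  obtain ⟨B, hne, hconn, hdisj, hB⟩ := h
  refine ⟨fun w => f '' B w, fun w => (hne w).image f, fun w => ?_,
    fun w₁ w₂ hw => (Set.disjoint_image_iff hf).2 (hdisj hw), fun w₁ w₂ hw => ?_⟩
  · let g : G'.induce (B w) →g G.induce (f '' B w) :=
      ⟨fun x => ⟨f x, x, x.2, rfl⟩, fun h => f.map_adj h⟩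
    refine (hconn w).map g ?_
    rintro ⟨-, x, hx, rfl⟩
    exact ⟨⟨x, hx⟩, rfl⟩
  · obtain ⟨a, ha, b, hb, hab⟩ := hB hw
    exact ⟨f a, ⟨a, ha, rfl⟩, f b, ⟨b, hb, rfl⟩, f.map_adj hab⟩

/-- Contracting pairwise disjoint stars (the fibres of `φ`, centred at the values of `σ`)
produces a minor. -/
theorem IsMinorOf.of_contract_stars {U V W : Type*} {H : SimpleGraph U} {G : SimpleGraph V}
    {G' : SimpleGraph W} (φ : V → W) (σ : W → V) (hσ : ∀ a, φ (σ a) = a)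
    (hstar : ∀ x, x = σ (φ x) ∨ G.Adj x (σ (φ x)))
    (hadj : ∀ a b, G'.Adj a b → ∃ x y, φ x = a ∧ φ y = b ∧ G.Adj x y)
    (h : H.IsMinorOf G') : H.IsMinorOf G := by
  obtain ⟨B, hne, hconn, hdisj, hB⟩ := h
  refine ⟨fun w => φ ⁻¹' B w, fun w => ?_, fun w => ?_, fun w₁ w₂ hw => ?_, fun w₁ w₂ hw => ?_⟩
  · obtain ⟨a, ha⟩ := hne w
    exact ⟨σ a, by simpa [hσ] using ha⟩
  · have center : ∀ (x : V) (hx : x ∈ φ ⁻¹' B w),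
        (G.induce (φ ⁻¹' B w)).Reachable ⟨x, hx⟩
          ⟨σ (φ x), by simpa [hσ] using hx⟩ := by
      intro x hx
      rcases hstar x with h | h
      · have : (⟨x, hx⟩ : φ ⁻¹' B w) = ⟨σ (φ x), by simpa [hσ] using hx⟩ := Subtype.ext h
        rw [← this]
      · exact Adj.reachable (by simpa using h)
    have lift : ∀ a b : B w, (G'.induce (B w)).Reachable a b →
        (G.induce (φ ⁻¹' B w)).Reachable
          ⟨σ a, by simp [hσ]⟩ ⟨σ b, by simp [hσ]⟩ := by
      rintro a b ⟨p⟩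
      induction p with
      | nil => exact Reachable.refl _
      | @cons a b c hab p ih =>
        refine Reachable.trans ?_ ih
        obtain ⟨x, y, hx, hy, hxy⟩ := hadj a b (by simpa using hab)
        have hxB : x ∈ φ ⁻¹' B w := by simp [hx]
        have hyB : y ∈ φ ⁻¹' B w := by simp [hy]
        have e : (G.induce (φ ⁻¹' B w)).Adj ⟨x, hxB⟩ ⟨y, hyB⟩ := by simpa using hxy
        have h := ((center x hxB).symm.trans e.reachable).trans (center y hyB)
        simpa only [hx, hy] using h
    obtain ⟨a, ha⟩ := hne w
    have : Nonempty (φ ⁻¹' B w) := ⟨⟨σ a, by simpa [hσ] using ha⟩⟩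
    refine ⟨fun x y => ?_⟩
    exact ((center x x.2).trans (lift ⟨φ x, x.2⟩ ⟨φ y, y.2⟩ ((hconn w).preconnected _ _))).trans
      (center y y.2).symm
  · exact (hdisj hw).preimage φ
  · obtain ⟨a, ha, b, hb, hab⟩ := hB hw
    obtain ⟨x, y, hx, hy, hxy⟩ := hadj a b hab
    exact ⟨x, by simpa [hx] using ha, y, by simpa [hy] using hb, hxy⟩

/-- Every finite set of vertices has a greedy (Grundy) colouring. -/
theorem exists_grundy_coloring {V : Type*} (G : SimpleGraph V) (S : Finset V) :
    ∃ f : V → ℕ, (∀ x ∈ S, ∀ y ∈ S, G.Adj x y → f x ≠ f y) ∧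
      ∀ x ∈ S, ∀ a < f x, ∃ y ∈ S, f y = a ∧ G.Adj x y := by
  classical
  induction S using Finset.induction_on with
  | empty => exact ⟨fun _ => 0, by simp, by simp⟩
  | insert x S hx ih =>
    obtain ⟨f, hf, hg⟩ := ih
    have hex : ∃ a, ¬ ∃ y ∈ S, f y = a ∧ G.Adj x y := by
      obtain ⟨a, ha⟩ := Infinite.exists_notMem_finset (S.image f)
      exact ⟨a, fun ⟨y, hy, hya, _⟩ => ha (Finset.mem_image.2 ⟨y, hy, hya⟩)⟩
    have hne : ∀ y ∈ S, y ≠ x := fun y hy h => hx (h ▸ hy)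
    refine ⟨Function.update f x (Nat.find hex), ?_, ?_⟩
    · intro y hy z hz hyz
      rcases Finset.mem_insert.1 hy with rfl | hyS <;> rcases Finset.mem_insert.1 hz with rfl | hzS
      · exact (G.loopless.irrefl _ hyz).elim
      · rw [Function.update_self, Function.update_of_ne (hne z hzS)]
        exact fun h => Nat.find_spec hex ⟨z, hzS, h.symm, hyz⟩
      · rw [Function.update_self, Function.update_of_ne (hne y hyS)]
        exact fun h => Nat.find_spec hex ⟨y, hyS, h, hyz.symm⟩
      · rw [Function.update_of_ne (hne y hyS), Function.update_of_ne (hne z hzS)]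
        exact hf y hyS z hzS hyz
    · intro y hy a ha
      rcases Finset.mem_insert.1 hy with rfl | hyS
      · rw [Function.update_self] at ha
        obtain ⟨z, hz, hza, hyz⟩ := not_not.1 (Nat.find_min hex ha)
        exact ⟨z, Finset.mem_insert_of_mem hz, by rwa [Function.update_of_ne (hne z hz)], hyz⟩
      · rw [Function.update_of_ne (hne y hyS)] at ha
        obtain ⟨z, hz, hza, hyz⟩ := hg y hyS a ha
        exact ⟨z, Finset.mem_insert_of_mem hz, by rwa [Function.update_of_ne (hne z hz)], hyz⟩

/-- If `G` is not colourable, every colour of a proper colouring of `G - v` occurs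
in the neighbourhood of `v`. -/
theorem exists_adj_color_eq {V C : Type*} {G : SimpleGraph V} {v : V}
    (hG : IsEmpty (G.Coloring C)) {c : V → C}
    (hc : ∀ x y, x ≠ v → y ≠ v → G.Adj x y → c x ≠ c y) (i : C) :
    ∃ u, G.Adj v u ∧ c u = i := by
  classical
  by_contra! h
  refine hG.false (Coloring.mk (Function.update c v i) ?_)
  intro x y hxy
  by_cases hx : x = v <;> by_cases hy : y = v
  · subst hx hy
    exact (G.loopless.irrefl _ hxy).elim
  · subst hx
    rw [Function.update_self, Function.update_of_ne hy]
    exact (h y hxy).symm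
  · subst hy
    rw [Function.update_self, Function.update_of_ne hx]
    exact h x hxy.symm
  · rw [Function.update_of_ne hy, Function.update_of_ne hx]
    exact hc x y hx hy hxy

/-- Kempe chains: if `G` is not colourable, two neighbours of `v` whose colours
are unique in the neighbourhood of `v` are joined by a two-coloured path avoiding `v`. -/
theorem reachable_kempe {V C : Type*} {G : SimpleGraph V} {v : V}
    (hG : IsEmpty (G.Coloring C)) {c : V → C}
    (hc : ∀ x y, x ≠ v → y ≠ v → G.Adj x y → c x ≠ c y) {u w : V} (hu : G.Adj v u)
    (hw : G.Adj v w) (hu' : ∀ y, G.Adj v y → c y = c u → y = u)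
    (hw' : ∀ y, G.Adj v y → c y = c w → y = w) :
    (G.induce {x | x ≠ v ∧ (c x = c u ∨ c x = c w)}).Reachable
      ⟨u, hu.ne', Or.inl rfl⟩ ⟨w, hw.ne', Or.inr rfl⟩ := by
  classical
  set S : Set V := {x | x ≠ v ∧ (c x = c u ∨ c x = c w)} with hS
  let R : V → Prop := fun x => ∃ h : x ∈ S, (G.induce S).Reachable ⟨u, hu.ne', Or.inl rfl⟩ ⟨x, h⟩
  have hstep : ∀ x y, R x → y ∈ S → G.Adj x y → R y := by
    rintro x y ⟨hx, hr⟩ hy hxy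
    have e : (G.induce S).Adj ⟨x, hx⟩ ⟨y, hy⟩ := by simpa using hxy
    exact ⟨hy, hr.trans e.reachable⟩
  let c' : V → C := fun x => if R x then Equiv.swap (c u) (c w) (c x) else c x
  have hmix : ∀ x y, y ≠ v → G.Adj x y → R x → ¬ R y → c' x ≠ c' y := by
    intro x y hyv hxy hx hy h
    have hyS : ¬ (c y = c u ∨ c y = c w) := fun h' => hy (hstep x y hx ⟨hyv, h'⟩ hxy)
    simp only [c', if_pos hx, if_neg hy] at h
    obtain ⟨⟨-, hcx | hcx⟩, -⟩ := hx
    · rw [hcx, Equiv.swap_apply_left] at h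
      exact hyS (Or.inr h.symm)
    · rw [hcx, Equiv.swap_apply_right] at h
      exact hyS (Or.inl h.symm)
  have hc' : ∀ x y, x ≠ v → y ≠ v → G.Adj x y → c' x ≠ c' y := by
    intro x y hx hy hxy
    by_cases hRx : R x <;> by_cases hRy : R y
    · simp only [c', if_pos hRx, if_pos hRy]
      exact fun h => hc x y hx hy hxy ((Equiv.swap (c u) (c w)).injective h)
    · exact hmix x y hy hxy hRx hRy
    · exact (hmix y x hx hxy.symm hRy hRx).symm
    · simp only [c', if_neg hRx, if_neg hRy]
      exact hc x y hx hy hxy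
  obtain ⟨z, hvz, hz⟩ := exists_adj_color_eq hG hc' (c u)
  by_cases hRz : R z
  · simp only [c', if_pos hRz] at hz
    have hzw : c z = c w := by
      rw [← Equiv.swap_apply_right (c u) (c w)] at hz
      exact (Equiv.swap (c u) (c w)).injective (by simpa using hz)
    obtain rfl := hw' z hvz hzw
    exact hRz.2
  · simp only [c', if_neg hRz] at hz
    obtain rfl := hu' z hvz hz
    exact (hRz ⟨⟨hu.ne', Or.inl rfl⟩, Reachable.refl _⟩).elim

/-- If `G` is not colourable and has no `K_{t+1}`-minor, the neighbours of `v` with unique colours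
contain a large independent set. -/
theorem KMinorFree.card_le_of_unique_colors {V C : Type*} {G : SimpleGraph V} {t : ℕ}
    (hm : G.KMinorFree (t + 1)) (ht : 1 ≤ t) {v : V}
    (hG : IsEmpty (G.Coloring C)) {c : V → C}
    (hc : ∀ x y, x ≠ v → y ≠ v → G.Adj x y → c x ≠ c y) (S : Finset V)
    (hS : ∀ u ∈ S, G.Adj v u ∧ ∀ y, G.Adj v y → c y = c u → y = u) {α : ℕ}
    (hα : ∀ I ⊆ S, G.IsIndepSet (I : Set V) → I.card ≤ α) :
    S.card ≤ α * (t - 1) := by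
  classical
  by_contra! hlt
  obtain ⟨f, hf, hg⟩ := G.exists_grundy_coloring S
  obtain ⟨x, hxS, hx⟩ : ∃ x ∈ S, t - 1 ≤ f x := by
    by_contra! h
    obtain ⟨a, -, ha⟩ := Finset.exists_lt_card_fiber_of_mul_lt_card_of_maps_to
      (s := S) (t := Finset.range (t - 1)) (f := f) (n := α)
      (fun x hx => Finset.mem_range.2 (h x hx)) (by rw [Finset.card_range, mul_comm]; exact hlt)
    refine absurd (hα _ (Finset.filter_subset _ S) ?_) (not_le.2 ha)
    intro y hy z hz _ hyz
    simp only [Finset.coe_filter, Set.mem_ofPred_eq] at hy hz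
    exact hf y hy.1 z hz.1 hyz (hy.2.trans hz.2.symm)
  have hcls : ∀ i : Fin t, ∃ u ∈ S, f u = i := by
    intro i
    rcases (show (i : ℕ) < f x ∨ f x = i by omega) with h | h
    · obtain ⟨y, hy, hya, -⟩ := hg x hxS i h
      exact ⟨y, hy, hya⟩
    · exact ⟨x, hxS, h⟩
  choose r hrS hr using hcls
  let P : Fin t → Set V := fun i => {x | x ≠ v ∧ ∃ u ∈ S, f u = i ∧ c x = c u}
  have hmem : ∀ i : Fin t, ∀ u ∈ S, f u = i → u ∈ P i := fun i u hu h =>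
    ⟨(hS u hu).1.ne', u, hu, h, rfl⟩
  let B : Fin t → Set V := fun i =>
    {x | ∃ h : x ∈ P i, (G.induce (P i)).Reachable ⟨r i, hmem i _ (hrS i) (hr i)⟩ ⟨x, h⟩}
  have hB : ∀ i : Fin t, ∀ u ∈ S, f u = i → u ∈ B i := by
    intro i u hu h
    refine ⟨hmem i u hu h, ?_⟩
    have hk := reachable_kempe hG hc (hS _ (hrS i)).1 (hS u hu).1 (hS _ (hrS i)).2 (hS u hu).2
    have hsub : {x | x ≠ v ∧ (c x = c (r i) ∨ c x = c u)} ⊆ P i := by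
      rintro y ⟨hyv, hy | hy⟩
      · exact ⟨hyv, r i, hrS i, hr i, hy⟩
      · exact ⟨hyv, u, hu, h, hy⟩
    exact hk.map (induceHomOfLE G hsub).toHom
  have hBconn : ∀ i, (G.induce (B i)).Connected := by
    intro i
    have hrB : r i ∈ B i := hB i _ (hrS i) (hr i)
    have key : ∀ (a b : P i) (ha : a.1 ∈ B i), (G.induce (P i)).Reachable a b →
        ∃ hb : b.1 ∈ B i, (G.induce (B i)).Reachable ⟨a.1, ha⟩ ⟨b.1, hb⟩ := by
      rintro a b ha ⟨p⟩
      induction p with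
      | nil => exact ⟨ha, Reachable.refl _⟩
      | @cons a b d hab p ih =>
        have hb : b.1 ∈ B i := ⟨b.2, ha.2.trans hab.reachable⟩
        obtain ⟨hd, h⟩ := ih hb
        have e : (G.induce (B i)).Adj ⟨a.1, ha⟩ ⟨b.1, hb⟩ := by simpa using hab
        exact ⟨hd, e.reachable.trans h⟩
    have hr' : ∀ y : B i, (G.induce (B i)).Reachable ⟨r i, hrB⟩ y := by
      rintro ⟨y, hy, hry⟩
      exact (key _ _ hrB hry).2
    have : Nonempty (B i) := ⟨⟨r i, hrB⟩⟩
    exact ⟨fun y z => (hr' y).symm.trans (hr' z)⟩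
  have hBdisj : ∀ i j, i ≠ j → Disjoint (B i) (B j) := by
    intro i j hij
    rw [Set.disjoint_left]
    rintro x ⟨⟨-, u, hu, hui, hxu⟩, -⟩ ⟨⟨-, w, hw, hwj, hxw⟩, -⟩
    have : u = w := (hS w hw).2 u (hS u hu).1 (hxu.symm.trans hxw)
    subst this
    exact hij (Fin.ext (hui.symm.trans hwj))
  have hvB : ∀ i, v ∉ B i := fun i h => h.1.1 rfl
  have hBadj : ∀ i j, i < j → ∃ x ∈ B i, ∃ y ∈ B j, G.Adj x y := by
    intro i j hij
    obtain ⟨y, hy, hyi, hadj⟩ := hg (r j) (hrS j) i (by rw [hr j]; exact hij)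
    exact ⟨y, hB i y hy hyi, r j, hB j _ (hrS j) (hr j), hadj.symm⟩
  refine hm ⟨Fin.cases {v} B, ?_, ?_, ?_, ?_⟩
  · intro w
    cases w using Fin.cases with
    | zero => exact ⟨v, rfl⟩
    | succ i => exact ⟨r i, hB i _ (hrS i) (hr i)⟩
  · intro w
    cases w using Fin.cases with
    | zero =>
      change (G.induce {v}).Connected
      exact ⟨fun y z => by rw [Subsingleton.elim y z]⟩
    | succ i => exact hBconn i
  · intro w₁ w₂ hw
    cases w₁ using Fin.cases with
    | zero =>
      cases w₂ using Fin.cases with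
      | zero => exact (hw rfl).elim
      | succ j => exact Set.disjoint_singleton_left.2 (hvB j)
    | succ i =>
      cases w₂ using Fin.cases with
      | zero => exact Set.disjoint_singleton_right.2 (hvB i)
      | succ j => exact hBdisj i j (fun h => hw (by rw [h]))
  · intro w₁ w₂ hw
    have hw : w₁ ≠ w₂ := hw.ne
    cases w₁ using Fin.cases with
    | zero =>
      cases w₂ using Fin.cases with
      | zero => exact (hw rfl).elim
      | succ j => exact ⟨v, rfl, r j, hB j _ (hrS j) (hr j), (hS _ (hrS j)).1⟩
    | succ i =>
      cases w₂ using Fin.cases with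
      | zero => exact ⟨r i, hB i _ (hrS i) (hr i), v, rfl, (hS _ (hrS i)).1.symm⟩
      | succ j =>
        rcases lt_or_gt_of_ne (fun h => hw (by rw [h]) : i ≠ j) with h | h
        · exact hBadj i j h
        · obtain ⟨x, hx, y, hy, hxy⟩ := hBadj j i h
          exact ⟨y, hy, x, hx, hxy.symm⟩

/-- Contracting the star formed by a vertex `v` and a nonempty independent set `I` of neighbours
of `v` gives a proper colouring of `G - v` in which `I` is the trace of a colour class on the
neighbourhood of `v`. -/
theorem exists_coloring_of_contract_star {V : Type} [Fintype V] {G : SimpleGraph V} {s k : ℕ}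
    (hm : G.KMinorFree s)
    (hmin : ∀ (W : Type) [Fintype W] (G' : SimpleGraph W), Fintype.card W < Fintype.card V →
      G'.KMinorFree s → G'.Colorable k)
    {v : V} {I : Finset V} (hI : G.IsIndepSet (I : Set V)) (hne : I.Nonempty)
    (hadj : ∀ x ∈ I, G.Adj v x) :
    ∃ (c : V → Fin k) (c₀ : Fin k), (∀ x y, x ≠ v → y ≠ v → G.Adj x y → c x ≠ c y) ∧
      ∀ x, G.Adj v x → (c x = c₀ ↔ x ∈ I) := by
  classical
  have hv : v ∉ I := fun h => G.loopless.irrefl _ (hadj v h)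
  let φ : V → {x // x ∉ I} := fun x => if h : x ∈ I then ⟨v, hv⟩ else ⟨x, h⟩
  have hφI : ∀ x ∈ I, φ x = ⟨v, hv⟩ := fun x h => dif_pos h
  have hφ : ∀ x (h : x ∉ I), φ x = ⟨x, h⟩ := fun x h => dif_neg h
  let G' : SimpleGraph {x // x ∉ I} :=
    SimpleGraph.fromRel fun a b => ∃ x y, φ x = a ∧ φ y = b ∧ G.Adj x y
  have hG' : ∀ x y, φ x ≠ φ y → G.Adj x y → G'.Adj (φ x) (φ y) := fun x y hne h =>
    (SimpleGraph.fromRel_adj _ _ _).2 ⟨hne, Or.inl ⟨x, y, rfl, rfl, h⟩⟩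
  have hcard : Fintype.card {x // x ∉ I} < Fintype.card V := by
    obtain ⟨x, hx⟩ := hne
    exact Fintype.card_subtype_lt (x := x) (by simpa using hx)
  have hfree : G'.KMinorFree s := by
    refine fun h => hm (h.of_contract_stars φ (fun a => a.1) (fun a => hφ a.1 a.2) ?_ ?_)
    · intro x
      by_cases hx : x ∈ I
      · rw [hφI x hx]
        exact Or.inr (hadj x hx).symm
      · rw [hφ x hx]
        exact Or.inl rfl
    · intro a b hab
      obtain ⟨-, ⟨x, y, hx, hy, h⟩ | ⟨x, y, hx, hy, h⟩⟩ := (SimpleGraph.fromRel_adj _ _ _).1 hab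
      · exact ⟨x, y, hx, hy, h⟩
      · exact ⟨y, x, hy, hx, h.symm⟩
  obtain ⟨d⟩ := hmin _ G' hcard hfree
  refine ⟨fun x => d (φ x), d ⟨v, hv⟩, ?_, ?_⟩
  · intro x y hxv hyv hxy
    refine d.valid (hG' x y ?_ hxy)
    intro h
    by_cases hx : x ∈ I <;> by_cases hy : y ∈ I
    · exact hI hx hy hxy.ne hxy
    · rw [hφI x hx, hφ y hy] at h
      exact hyv (congrArg Subtype.val h).symm
    · rw [hφ x hx, hφI y hy] at h
      exact hxv (congrArg Subtype.val h)
    · rw [hφ x hx, hφ y hy] at h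
      exact hxy.ne (congrArg Subtype.val h)
  · intro x hx
    refine ⟨fun h => ?_, fun h => by simp only [hφI x h]⟩
    by_contra hxI
    refine d.valid (hG' v x ?_ hx) (by simpa only [hφ v hv] using h.symm)
    rw [hφ v hv, hφ x hxI]
    exact fun h => hx.ne (congrArg Subtype.val h)

/-- If all `K_{t+1}`-minor-free graphs have minimum degree at most `δ`, then they are
`k`-colourable whenever `k - 1 > δ (1 - 1/t)`. -/
theorem KMinorFree.colorable {t δ k : ℕ} (ht : 2 ≤ t) (hk : δ * (t - 1) < t * (k - 1))
    (hδ : ∀ (V : Type) [Fintype V] (G : SimpleGraph V) [DecidableRel G.Adj],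
      G.KMinorFree (t + 1) → G.minDegree ≤ δ)
    (V : Type) [Fintype V] (G : SimpleGraph V) (hG : G.KMinorFree (t + 1)) :
    G.Colorable k := by
  classical
  induction hn : Fintype.card V using Nat.strong_induction_on generalizing V with
  | _ n ih =>
  subst hn
  by_contra hcol
  have hemp : IsEmpty (G.Coloring (Fin k)) := not_nonempty_iff.1 hcol
  have hk1 : 1 < k := by
    by_contra! h
    rw [Nat.sub_eq_zero_of_le h] at hk
    omega
  have : Nonempty V := by
    by_contra h
    rw [not_nonempty_iff] at h
    exact hcol (.of_isEmpty k)
  obtain ⟨v, hv⟩ := G.exists_minimal_degree_vertex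
  have hD : (G.neighborFinset v).card ≤ δ := by
    rw [G.card_neighborFinset_eq_degree, ← hv]
    exact hδ V G hG
  obtain ⟨I, hImem, hImax⟩ := Finset.exists_max_image
    ((G.neighborFinset v).powerset.filter fun I : Finset V => G.IsIndepSet (I : Set V)) Finset.card
    ⟨∅, by simp [SimpleGraph.IsIndepSet]⟩
  simp only [Finset.mem_filter, Finset.mem_powerset] at hImem hImax
  have hIne : I.Nonempty := by
    by_contra hIe
    rw [Finset.not_nonempty_iff_eq_empty] at hIe
    have hiso : ∀ x, ¬ G.Adj v x := by
      intro x hx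
      have := hImax {x} ⟨by simpa using hx, by simp [SimpleGraph.IsIndepSet]⟩
      simp [hIe] at this
    have hcol' : (G.induce {x | x ≠ v}).Colorable k := by
      refine ih _ (Fintype.card_subtype_lt (x := v) (by simp)) {x // x ≠ v} _ ?_ rfl
      exact fun h => hG (h.of_injective_hom (Embedding.induce _).toHom Subtype.val_injective)
    obtain ⟨d⟩ := hcol'
    obtain ⟨u, hu, -⟩ := exists_adj_color_eq hemp
      (c := fun x => if h : x ≠ v then d ⟨x, h⟩ else ⟨0, by omega⟩) (v := v)
      (fun x y hx hy hxy => by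
        simp only [dif_pos hx, dif_pos hy]
        exact d.valid (by simpa using hxy)) ⟨0, by omega⟩
    exact hiso u hu
  obtain ⟨c, c₀, hc, hc₀⟩ := exists_coloring_of_contract_star hG
    (fun W _ G' hW hG' => ih _ hW W G' hG' rfl) hImem.2 hIne
    (fun x hx => by simpa using hImem.1 hx)
  set N := G.neighborFinset v with hN
  let S := N.filter fun u => c u ≠ c₀ ∧ ∀ y, G.Adj v y → c y = c u → y = u
  have hS : S.card ≤ I.card * (t - 1) := by
    refine hG.card_le_of_unique_colors (by omega) hemp hc S ?_ ?_
    · intro u hu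
      simp only [S, hN, Finset.mem_filter, mem_neighborFinset] at hu
      exact ⟨hu.1, hu.2.2⟩
    · exact fun J hJ hJi => hImax J ⟨hJ.trans (Finset.filter_subset _ _), hJi⟩
  have hfib : ∀ i, 1 ≤ (N.filter fun x => c x = i).card := by
    intro i
    obtain ⟨u, hu, hui⟩ := exists_adj_color_eq hemp hc i
    exact Finset.card_pos.2 ⟨u, by simp [hN, hu, hui]⟩
  have hfib₀ : (N.filter fun x => c x = c₀).card = I.card := by
    congr 1
    ext x
    simp only [hN, Finset.mem_filter, mem_neighborFinset]
    refine ⟨fun h => (hc₀ x h.1).1 h.2, fun h => ?_⟩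
    have hx : G.Adj v x := by simpa [hN] using hImem.1 h
    exact ⟨hx, (hc₀ x hx).2 h⟩
  have hsum : N.card = I.card +
      ∑ i ∈ Finset.univ.erase c₀, (N.filter fun x => c x = i).card := by
    rw [Finset.card_eq_sum_card_fiberwise (f := c) (t := Finset.univ) (by simp),
      ← Finset.add_sum_erase _ _ (Finset.mem_univ c₀), hfib₀]
  have hcardk : (Finset.univ.erase c₀).card = k - 1 := by
    rw [Finset.card_erase_of_mem (Finset.mem_univ _), Finset.card_univ, Fintype.card_fin]
  have h₁ : k - 1 ≤ ∑ i ∈ Finset.univ.erase c₀, (N.filter fun x => c x = i).card := by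
    rw [← hcardk, Finset.card_eq_sum_ones]
    exact Finset.sum_le_sum fun i _ => hfib i
  have h₂ : 2 * (k - 1) ≤
      ∑ i ∈ Finset.univ.erase c₀, (N.filter fun x => c x = i).card + S.card := by
    let T := (Finset.univ.erase c₀).filter fun i => (N.filter fun x => c x = i).card = 1
    have hT : T.card ≤ S.card := by
      refine (Finset.card_le_card (t := S.image c) ?_).trans Finset.card_image_le
      intro i hi
      simp only [T, Finset.mem_filter, Finset.mem_erase, Finset.card_eq_one] at hi
      obtain ⟨⟨hi₀, -⟩, u, hu⟩ := hi
      have huN : u ∈ N ∧ c u = i := by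
        have : u ∈ N.filter fun x => c x = i := by simp [hu]
        simpa using this
      refine Finset.mem_image.2 ⟨u, Finset.mem_filter.2 ⟨huN.1, huN.2 ▸ hi₀, fun y hy hyu => ?_⟩,
        huN.2⟩
      have : y ∈ N.filter fun x => c x = i := by simp [hN, hy, hyu, huN.2]
      simpa [hu] using this
    refine le_trans ?_ (Nat.add_le_add_left hT _)
    rw [← hcardk, Finset.card_filter, ← Finset.sum_add_distrib, mul_comm, ← smul_eq_mul,
      ← Finset.sum_const]
    refine Finset.sum_le_sum fun i _ => ?_
    have := hfib i
    split_ifs with h <;> omega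
  obtain ⟨m, rfl⟩ : ∃ m, t = m + 2 := ⟨t - 2, by omega⟩
  obtain ⟨l, rfl⟩ : ∃ l, k = l + 1 := ⟨k - 1, by omega⟩
  simp only [Nat.add_sub_cancel, show m + 2 - 1 = m + 1 by omega] at *
  generalize ∑ i ∈ Finset.univ.erase c₀, (N.filter fun x => c x = i).card = q at *
  nlinarith [Nat.mul_le_mul_left m (show l + I.card ≤ N.card by omega),
    Nat.mul_le_mul_right (m + 1) hD]

end SimpleGraph

/-- With `γ = (80 - √5392)/126`: if every `K_{t+1}`-minor-free graph (`t ≥ 6`) has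
minimum degree at most `δ`, then every `K_{t+1}`-minor-free graph `G` satisfies
`χ(G) ≤ δ(1 - 1/((2 - γ)(t - 1))) + 2`. -/
theorem chromatic_bound_two (γ : ℝ) (hγ : γ = (80 - Real.sqrt 5392) / 126)
    (t δ : ℕ) (ht : 6 ≤ t)
    (hδ : ∀ (V : Type) [Fintype V] (G : SimpleGraph V) [DecidableRel G.Adj],
      G.KMinorFree (t + 1) → G.minDegree ≤ δ)
    (V : Type) [Fintype V] (G : SimpleGraph V) (hG : G.KMinorFree (t + 1)) :
    (G.chromaticNumber.toNat : ℝ) ≤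
      (δ : ℝ) * (1 - 1 / ((2 - γ) * ((t : ℝ) - 1))) + 2 := by
  have ht' : (6 : ℝ) ≤ t := by exact_mod_cast ht
  set q := δ * (t - 1) / t with hq
  have hcol : G.Colorable (q + 2) := by
    refine SimpleGraph.KMinorFree.colorable (by omega) ?_ hδ V G hG
    have := Nat.lt_mul_div_succ (δ * (t - 1)) (show 0 < t by omega)
    simpa [hq] using this
  have hchi : (G.chromaticNumber.toNat : ℝ) ≤ q + 2 := by
    have := ENat.toNat_le_of_le_natCast hcol.chromaticNumber_le
    exact_mod_cast this
  have hqt : (q : ℝ) ≤ δ * (1 - 1 / t) := by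
    have h : (q : ℝ) ≤ ((δ * (t - 1) : ℕ) : ℝ) / t := Nat.cast_div_le
    rw [Nat.cast_mul, Nat.cast_sub (by omega), Nat.cast_one] at h
    refine h.trans (le_of_eq ?_)
    field_simp
  have hγ' : γ ≤ 8 / 126 := by
    have : (72 : ℝ) ≤ Real.sqrt 5392 := Real.le_sqrt_of_sq_le (by norm_num)
    rw [hγ]
    linarith
  have hle : 1 / ((2 - γ) * ((t : ℝ) - 1)) ≤ 1 / t :=
    one_div_le_one_div_of_le (by linarith) (by nlinarith)
  have := mul_le_mul_of_nonneg_left hle (Nat.cast_nonneg (α := ℝ) δ)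
  linarith
end

section
/- Every K_9-minor-free graph on exactly 21 vertices has an independent set of size 3. -/
namespace SimpleGraph

variable {V : Type*} {G : SimpleGraph V}

/-- Among any three distinct vertices of `G` there is an edge. -/
def NoIndepThree (G : SimpleGraph V) : Prop :=
  ∀ ⦃a b c : V⦄, a ≠ b → a ≠ c → b ≠ c → G.Adj a b ∨ G.Adj a c ∨ G.Adj b c

/-- The members of `F` are the branch sets of a complete minor of `G` inside `S`. -/
structure IsCliqueModel (G : SimpleGraph V) (S : Finset V) (F : Finset (Finset V)) : Prop where
  subset : ∀ B ∈ F, B ⊆ S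
  connected : ∀ B ∈ F, (G.induce (B : Set V)).Connected
  disjoint : ∀ A ∈ F, ∀ B ∈ F, A ≠ B → Disjoint A B
  adj : ∀ A ∈ F, ∀ B ∈ F, A ≠ B → ∃ a ∈ A, ∃ b ∈ B, G.Adj a b

/-- `G` has a `K_t` minor with branch sets contained in `S`. -/
def HasCliqueModel (G : SimpleGraph V) (S : Finset V) (t : ℕ) : Prop :=
  ∃ F : Finset (Finset V), F.card = t ∧ G.IsCliqueModel S F

theorem connected_induce_of_star {P : Finset V} {b : V} (hb : b ∈ P)
    (h : ∀ x ∈ P, x = b ∨ G.Adj b x) : (G.induce (P : Set V)).Connected := by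
  rw [connected_iff_exists_forall_reachable]
  refine ⟨⟨b, hb⟩, ?_⟩
  rintro ⟨x, hx⟩
  rcases h x hx with rfl | h
  · exact Reachable.refl _
  · exact Adj.reachable (G := G.induce (P : Set V)) h

theorem IsClique.hasCliqueModel {S K : Finset V} {t : ℕ} (hK : G.IsClique (K : Set V))
    (hKS : K ⊆ S) (ht : t ≤ K.card) : G.HasCliqueModel S t := by
  classical
  obtain ⟨L, hLK, rfl⟩ := Finset.exists_subset_card_eq ht
  refine ⟨L.image fun v => {v}, Finset.card_image_of_injective _ Finset.singleton_injective,
    ?_, ?_, ?_, ?_⟩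
  all_goals simp only [Finset.forall_mem_image]
  · intro v hv
    simpa using hKS (hLK hv)
  · intro v _
    exact connected_induce_of_star (b := v) (by simp) (by simp)
  · intro v _ w _ h
    simpa [eq_comm] using h
  · intro v hv w hw h
    exact ⟨v, by simp, w, by simp, hK (hLK hv) (hLK hw) (by simpa using h)⟩

theorem IsCliqueModel.insert_hasCliqueModel {S T P : Finset V} {F : Finset (Finset V)}
    (hF : G.IsCliqueModel T F) (hTS : T ⊆ S) (hPS : P ⊆ S) (hPT : Disjoint P T)
    (hP : (G.induce (P : Set V)).Connected)
    (hadj : ∀ B ∈ F, ∃ p ∈ P, ∃ b ∈ B, G.Adj p b) : G.HasCliqueModel S (F.card + 1) := by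
  classical
  have hdisj : ∀ B ∈ F, Disjoint P B := fun B hB => hPT.mono_right (hF.subset B hB)
  have hPF : P ∉ F := by
    intro h
    obtain ⟨⟨x, hx⟩⟩ := hP.nonempty
    exact Finset.disjoint_left.1 (hdisj P h) hx hx
  refine ⟨insert P F, Finset.card_insert_of_notMem hPF, ?_, ?_, ?_, ?_⟩
  · intro B hB
    rcases Finset.mem_insert.1 hB with rfl | hB
    · exact hPS
    · exact (hF.subset B hB).trans hTS
  · intro B hB
    rcases Finset.mem_insert.1 hB with rfl | hB
    · exact hP
    · exact hF.connected B hB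
  · intro A hA B hB hAB
    rcases Finset.mem_insert.1 hA with rfl | hA' <;> rcases Finset.mem_insert.1 hB with rfl | hB'
    · exact absurd rfl hAB
    · exact hdisj B hB'
    · exact (hdisj A hA').symm
    · exact hF.disjoint A hA' B hB' hAB
  · intro A hA B hB hAB
    rcases Finset.mem_insert.1 hA with rfl | hA' <;> rcases Finset.mem_insert.1 hB with rfl | hB'
    · exact absurd rfl hAB
    · exact hadj B hB'
    · obtain ⟨p, hp, b, hb, h⟩ := hadj A hA'
      exact ⟨b, hb, p, hp, h.symm⟩
    · exact hF.adj A hA' B hB' hAB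

theorem HasCliqueModel.isMinorOf {S : Finset V} {t : ℕ} (h : G.HasCliqueModel S t) :
    (completeGraph (Fin t)).IsMinorOf G := by
  obtain ⟨F, rfl, hF⟩ := h
  let e := F.equivFin.symm
  have hne : ∀ {i j}, i ≠ j → (e i).1 ≠ (e j).1 := fun hij h =>
    hij (e.injective (Subtype.ext h))
  refine ⟨fun i => ((e i).1 : Set V), ?_, fun i => hF.connected _ (e i).2, ?_, ?_⟩
  · intro i
    obtain ⟨⟨x, hx⟩⟩ := (hF.connected _ (e i).2).nonempty
    exact ⟨x, hx⟩
  · intro i j hij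
    exact Finset.disjoint_coe.2 (hF.disjoint _ (e i).2 _ (e j).2 (hne hij))
  · intro i j hij
    exact hF.adj _ (e i).2 _ (e j).2 (hne hij)

namespace NoIndepThree

theorem isClique_of_not_adj (hG : G.NoIndepThree) {X : Finset V} {w : V}
    (h : ∀ x ∈ X, x ≠ w ∧ ¬ G.Adj w x) : G.IsClique (X : Set V) := by
  intro x hx y hy hxy
  rcases hG (h x hx).1.symm (h y hy).1.symm hxy with h' | h' | h'
  · exact absurd h' (h x hx).2
  · exact absurd h' (h y hy).2
  · exact h'

theorem exists_triangle (hG : G.NoIndepThree) {N : Finset V} (hN : 6 ≤ N.card) :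
    ∃ K ⊆ N, G.IsClique (K : Set V) ∧ 3 ≤ K.card := by
  classical
  obtain ⟨v, hv⟩ : N.Nonempty := Finset.card_pos.1 (by omega)
  have hsum := Finset.card_filter_add_card_filter_not (s := N.erase v) (fun x => G.Adj v x)
  rw [Finset.card_erase_of_mem hv] at hsum
  by_cases h3 : 3 ≤ ((N.erase v).filter fun x => ¬ G.Adj v x).card
  · refine ⟨_, (Finset.filter_subset _ _).trans (Finset.erase_subset _ _),
      hG.isClique_of_not_adj (w := v) ?_, h3⟩
    simp +contextual
  · obtain ⟨a, b, c, ha, hb, hc, hab, hac, hbc⟩ := Finset.two_lt_card_iff.1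
      (show 2 < ((N.erase v).filter fun x => G.Adj v x).card by omega)
    simp only [Finset.mem_filter, Finset.mem_erase] at ha hb hc
    have key : ∀ x y, x ∈ N → y ∈ N → G.Adj v x → G.Adj v y → G.Adj x y →
        ∃ K ⊆ N, G.IsClique (K : Set V) ∧ 3 ≤ K.card := by
      intro x y hx hy hvx hvy hxy
      refine ⟨{v, x, y}, by grind, ?_, ?_⟩
      · simp [isClique_insert, hvx, hvy, hxy]
      · rw [Finset.card_eq_three.2 ⟨v, x, y, hvx.ne, hvy.ne, hxy.ne, rfl⟩]
    rcases hG hab hac hbc with h | h | h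
    · exact key a b ha.1.2 hb.1.2 ha.2 hb.2 h
    · exact key a c ha.1.2 hc.1.2 ha.2 hc.2 h
    · exact key b c hb.1.2 hc.1.2 hb.2 hc.2 h

end NoIndepThree

theorem IsClique.union_filter [DecidableEq V] {X K : Finset V} (p : V → Prop) [DecidablePred p]
    (hX : G.IsClique (X : Set V)) (hK : G.IsClique (K : Set V))
    (hp : ∀ a, p a → ∀ x ∈ X, G.Adj a x) : G.IsClique ((X ∪ K.filter p : Finset V) : Set V) := by
  intro a ha b hb hab
  simp only [Finset.coe_union, Set.mem_union, Finset.mem_coe, Finset.mem_filter] at ha hb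
  rcases ha with ha | ha <;> rcases hb with hb | hb
  · exact hX ha hb hab
  · exact (hp b hb.2 a ha).symm
  · exact hp a ha.2 b hb
  · exact hK ha.1 hb.1 hab

theorem degree_induce_eq_card_filter [DecidableRel G.Adj] (S : Finset V) (v : S) :
    (G.induce (S : Set V)).degree v = (S.filter fun x => G.Adj v x).card := by
  classical
  rw [← card_neighborFinset_eq_degree]
  refine Finset.card_bij (fun x _ => x.1) ?_ ?_ ?_
  · rintro ⟨x, hx⟩ h
    simpa using And.intro hx h
  · intro x _ y _ h
    exact Subtype.ext h
  · intro x hx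
    rw [Finset.mem_filter] at hx
    exact ⟨⟨x, hx.1⟩, by simpa using hx.2, rfl⟩

namespace NoIndepThree

theorem exists_isClique_four (hG : G.NoIndepThree) {S : Finset V} (hS : S.card = 9) :
    ∃ K ⊆ S, G.IsClique (K : Set V) ∧ 4 ≤ K.card := by
  classical
  by_contra! hno
  have hdeg : ∀ v ∈ S, (S.filter fun x => G.Adj v x).card = 5 := by
    intro v hv
    have hsum := Finset.card_filter_add_card_filter_not (s := S.erase v) (fun x => G.Adj v x)
    have hfilter : ((S.erase v).filter fun x => G.Adj v x) = S.filter fun x => G.Adj v x := by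
      ext x
      have := fun h : G.Adj v x => h.ne'
      simp only [Finset.mem_filter, Finset.mem_erase]
      tauto
    rw [Finset.card_erase_of_mem hv, hfilter] at hsum
    have hnon := hno ((S.erase v).filter fun x => ¬ G.Adj v x)
      ((Finset.filter_subset _ _).trans (Finset.erase_subset _ _))
      (hG.isClique_of_not_adj (w := v) (by simp +contextual))
    have hnbr : (S.filter fun x => G.Adj v x).card < 6 := by
      by_contra! h6
      obtain ⟨K, hKN, hK, hcard⟩ := hG.exists_triangle h6
      have hvK : v ∉ K := fun h => by simpa using hKN h
      have hlt := hno (insert v K)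
        (Finset.insert_subset hv (hKN.trans (Finset.filter_subset _ _))) (by
          rw [Finset.coe_insert, isClique_insert]
          exact ⟨hK, fun x hx _ => (Finset.mem_filter.1 (hKN hx)).2⟩)
      rw [Finset.card_insert_of_notMem hvK] at hlt
      omega
    omega
  have hsum := (G.induce (S : Set V)).sum_degrees_eq_twice_card_edges
  rw [Finset.sum_congr rfl (g := fun _ => 5) fun v _ => by
    rw [degree_induce_eq_card_filter S v]; exact hdeg v v.2] at hsum
  simp [hS] at hsum
  omega

theorem connected_or_exists_cut (hG : G.NoIndepThree) {R : Finset V} (hR : R.Nonempty) :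
    (G.induce (R : Set V)).Connected ∨ ∃ X ⊆ R, ∃ Y ⊆ R, X.card + Y.card = R.card ∧
      G.IsClique (X : Set V) ∧ G.IsClique (Y : Set V) ∧
      ∀ x ∈ X, ∀ y ∈ Y, x ≠ y ∧ ¬ G.Adj x y := by
  classical
  refine or_iff_not_imp_left.2 fun hconn => ?_
  obtain ⟨v, hv⟩ := hR
  rw [connected_iff_exists_forall_reachable] at hconn
  push Not at hconn
  obtain ⟨w, hw⟩ := hconn ⟨v, hv⟩
  let p : V → Prop := fun x => ∃ hx : x ∈ R, (G.induce (R : Set V)).Reachable ⟨v, hv⟩ ⟨x, hx⟩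
  have hcut : ∀ x ∈ R.filter p, ∀ y ∈ R.filter (fun x => ¬ p x), x ≠ y ∧ ¬ G.Adj x y := by
    intro x hx y hy
    rw [Finset.mem_filter] at hx hy
    refine ⟨fun h => hy.2 (h ▸ hx.2), fun h => hy.2 ?_⟩
    obtain ⟨hxR, hvx⟩ := hx.2
    exact ⟨hy.1, hvx.trans (Adj.reachable (G := G.induce (R : Set V)) h)⟩
  have hwY : w.1 ∈ R.filter fun x => ¬ p x :=
    Finset.mem_filter.2 ⟨w.2, fun ⟨_, h⟩ => hw h⟩
  have hvX : v ∈ R.filter p := Finset.mem_filter.2 ⟨hv, hv, Reachable.refl _⟩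
  refine ⟨_, Finset.filter_subset p R, _, Finset.filter_subset _ R,
    Finset.card_filter_add_card_filter_not p, ?_, ?_, hcut⟩
  · refine hG.isClique_of_not_adj (w := w.1) fun x hx => ?_
    exact ⟨(hcut x hx w hwY).1, fun h => (hcut x hx w hwY).2 h.symm⟩
  · refine hG.isClique_of_not_adj (w := v) fun y hy => ?_
    exact ⟨(hcut v hvX y hy).1.symm, (hcut v hvX y hy).2⟩

theorem hasCliqueModel_of_isClique (hG : G.NoIndepThree) {S K : Finset V} {t : ℕ} (hKS : K ⊆ S)
    (hK : G.IsClique (K : Set V)) (ht : t ≤ K.card) (hS : 2 * t < S.card) :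
    G.HasCliqueModel S (t + 1) := by
  classical
  obtain ⟨L, hLK, rfl⟩ := Finset.exists_subset_card_eq ht
  have hL : G.IsClique (L : Set V) := hK.subset (Finset.coe_subset.2 hLK)
  have hLS := hLK.trans hKS
  have hRcard := Finset.card_sdiff_add_card_eq_card hLS
  have hR : (S \ L).Nonempty := Finset.card_pos.1 (by omega)
  rcases hG.connected_or_exists_cut hR with hconn | ⟨X, hXR, Y, hYR, hXY, hX, hY, hcut⟩
  · by_cases hnbr : ∀ a ∈ L, ∃ r ∈ S \ L, G.Adj a r
    · obtain ⟨F, hFcard, hF⟩ := hL.hasCliqueModel subset_rfl le_rfl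
      rw [← hFcard]
      refine hF.insert_hasCliqueModel hLS Finset.sdiff_subset Finset.sdiff_disjoint hconn
        fun B hB => ?_
      obtain ⟨⟨a, ha⟩⟩ := (hF.connected B hB).nonempty
      obtain ⟨r, hr, har⟩ := hnbr a (hF.subset B hB ha)
      exact ⟨r, hr, a, ha, har.symm⟩
    · push Not at hnbr
      obtain ⟨a, ha, hnon⟩ := hnbr
      refine IsClique.hasCliqueModel (K := S \ L)
        (hG.isClique_of_not_adj (w := a) fun x hx => ⟨?_, hnon x hx⟩) Finset.sdiff_subset
        (by omega)
      rintro rfl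
      exact (Finset.mem_sdiff.1 hx).2 ha
  · obtain ⟨p, hp⟩ : ∃ p : V → Prop, ∀ a, p a ↔ ∀ x ∈ X, G.Adj a x := ⟨_, fun _ => Iff.rfl⟩
    obtain ⟨q, hq⟩ : ∃ q : V → Prop, ∀ a, q a ↔ ∀ y ∈ Y, G.Adj a y := ⟨_, fun _ => Iff.rfl⟩
    have hdisj : ∀ (Z : Finset V) (r : V → Prop), Z ⊆ S \ L →
        (Z ∪ L.filter r).card = Z.card + (L.filter r).card := by
      intro Z r hZ
      refine Finset.card_union_of_disjoint (Finset.disjoint_left.2 fun x hx hx' => ?_)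
      exact (Finset.mem_sdiff.1 (hZ hx)).2 (Finset.mem_filter.1 hx').1
    have hcover : L.card ≤ (L.filter p).card + (L.filter q).card := by
      refine le_trans (Finset.card_le_card fun a ha => ?_) (Finset.card_union_le _ _)
      rw [Finset.mem_union, Finset.mem_filter, Finset.mem_filter]
      by_contra! hpq
      obtain ⟨x, hx, hax⟩ := not_forall₂.1 (mt (hp a).2 (hpq.1 ha))
      obtain ⟨y, hy, hay⟩ := not_forall₂.1 (mt (hq a).2 (hpq.2 ha))
      have hxa : a ≠ x := by
        rintro rfl
        exact (Finset.mem_sdiff.1 (hXR hx)).2 ha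
      have hya : a ≠ y := by
        rintro rfl
        exact (Finset.mem_sdiff.1 (hYR hy)).2 ha
      rcases hG hxa hya (hcut x hx y hy).1 with h | h | h
      · exact hax h
      · exact hay h
      · exact (hcut x hx y hy).2 h
    have hsub : ∀ (Z : Finset V) (r : V → Prop), Z ⊆ S \ L → Z ∪ L.filter r ⊆ S :=
      fun Z r hZ => Finset.union_subset (hZ.trans Finset.sdiff_subset)
        ((Finset.filter_subset _ _).trans hLS)
    have hXc := hdisj X p hXR
    have hYc := hdisj Y q hYR
    by_cases hbig : L.card + 1 ≤ (X ∪ L.filter p).card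
    · exact (hX.union_filter p hL fun a => (hp a).1).hasCliqueModel
        (hsub X p hXR) hbig
    · exact (hY.union_filter q hL fun a => (hq a).1).hasCliqueModel
        (hsub Y q hYR) (by omega)

theorem exists_induced_path_or_isClique (hG : G.NoIndepThree) (S : Finset V) :
    (∃ a ∈ S, ∃ b ∈ S, ∃ c ∈ S, a ≠ c ∧ G.Adj b a ∧ G.Adj b c ∧ ¬ G.Adj a c) ∨
      ∃ K ⊆ S, G.IsClique (K : Set V) ∧ S.card ≤ 2 * K.card := by
  classical
  refine or_iff_not_imp_left.2 fun hP => ?_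
  push Not at hP
  obtain rfl | ⟨v, hv⟩ := S.eq_empty_or_nonempty
  · exact ⟨∅, subset_rfl, by simp, by simp⟩
  let p : V → Prop := fun x => G.Adj v x
  have hsum := Finset.card_filter_add_card_filter_not (s := S.erase v) p
  rw [Finset.card_erase_of_mem hv] at hsum
  by_cases hbig : S.card ≤ 2 * ((S.erase v).filter fun x => ¬ p x).card
  · exact ⟨_, (Finset.filter_subset _ _).trans (Finset.erase_subset _ _),
      hG.isClique_of_not_adj (w := v) (by simp +contextual [p]), hbig⟩
  · refine ⟨insert v ((S.erase v).filter p), Finset.insert_subset hv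
      ((Finset.filter_subset _ _).trans (Finset.erase_subset _ _)), ?_, ?_⟩
    · rw [Finset.coe_insert, isClique_insert]
      refine ⟨fun x hx y hy hxy => ?_, fun x hx _ => (Finset.mem_filter.1 hx).2⟩
      simp only [Finset.mem_coe, Finset.mem_filter, Finset.mem_erase] at hx hy
      exact hP x hx.1.2 v hv y hy.1.2 hxy hx.2 hy.2
    · rw [Finset.card_insert_of_notMem (by simp)]
      omega

theorem hasCliqueModel (hG : G.NoIndepThree) (k : ℕ) :
    ∀ S : Finset V, S.card = 9 + 3 * k → G.HasCliqueModel S (5 + k) := by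
  classical
  induction k with
  | zero =>
    intro S hS
    obtain ⟨K, hKS, hK, hcard⟩ := hG.exists_isClique_four hS
    exact hG.hasCliqueModel_of_isClique hKS hK hcard (by omega)
  | succ k ih =>
    intro S hS
    rcases hG.exists_induced_path_or_isClique S with
      ⟨a, ha, b, hb, c, hc, hac, hba, hbc, hnac⟩ | ⟨K, hKS, hK, hcard⟩
    · have hPS : ({b, a, c} : Finset V) ⊆ S := by grind
      have hPcard : ({b, a, c} : Finset V).card = 3 :=
        Finset.card_eq_three.2 ⟨b, a, c, hba.ne, hbc.ne, hac, rfl⟩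
      have hT := Finset.card_sdiff_add_card_eq_card hPS
      obtain ⟨F, hFcard, hF⟩ := ih (S \ {b, a, c}) (by omega)
      rw [← add_assoc, ← hFcard]
      refine hF.insert_hasCliqueModel Finset.sdiff_subset hPS Finset.disjoint_sdiff
        (connected_induce_of_star (b := b) (by simp) (by simp [hba, hbc])) fun B hB => ?_
      obtain ⟨⟨x, hx⟩⟩ := (hF.connected B hB).nonempty
      have hxT := (Finset.mem_sdiff.1 (hF.subset B hB hx)).2
      simp only [Finset.mem_insert, Finset.mem_singleton, not_or] at hxT
      rcases hG hac (Ne.symm hxT.2.1) (Ne.symm hxT.2.2) with h | h | h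
      · exact absurd h hnac
      · exact ⟨a, by simp, x, hx, h⟩
      · exact ⟨c, by simp, x, hx, h⟩
    · exact hK.hasCliqueModel hKS (by omega)

end NoIndepThree

end SimpleGraph

/-- Every `K_9`-minor-free graph on exactly 21 vertices has an independent set of size 3. -/
theorem K9_minor_free_indep_three
    (V : Type) [Fintype V] (G : SimpleGraph V) (hcard : Fintype.card V = 21)
    (hG : G.KMinorFree 9) :
    ∃ S : Finset V, S.card = 3 ∧ ∀ v ∈ S, ∀ w ∈ S, v ≠ w → ¬ G.Adj v w := by
  classical
  by_contra! hno
  have hindep : G.NoIndepThree := by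
    intro a b c hab hac hbc
    obtain ⟨v, hv, w, hw, hvw, h⟩ :=
      hno {a, b, c} (Finset.card_eq_three.2 ⟨a, b, c, hab, hac, hbc, rfl⟩)
    have := h.symm
    simp only [Finset.mem_insert, Finset.mem_singleton] at hv hw
    rcases hv with rfl | rfl | rfl <;> rcases hw with rfl | rfl | rfl <;> tauto
  exact hG (hindep.hasCliqueModel 4 Finset.univ (by simp [hcard])).isMinorOf
end
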